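/- Double robustness of AIPW (outcome model correct, propensity possibly wrong): if μ(X,a) = E[Y | X, A=a] is the true outcome regression and π(X) is any measurable function with 0 < c₁ ≤ π(X) ≤ c₂ < 1 a.s. (possibly misspecified propensity model), then under ignorability E[ AY/π(X) + (1 − A/π(X))·μ(X,1) − (1−A)Y/(1−π(X)) − (1 − (1−A)/(1−π(X)))·μ(X,0) ] = τ₀. -/

import Mathlib

open MeasureTheory ProbabilityTheory

theorem condExp_mul_of_condIndepFun_aux
    {Ω : Type*} {m' mΩ : MeasurableSpace Ω} [StandardBorelSpace Ω]
    (μ : Measure Ω) [IsProbabilityMeasure μ] (hm : m' ≤ mΩ)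
    (B W : Ω → ℝ) (hB : Measurable B) (hBb : ∀ ω, ‖B ω‖ ≤ 1) (hW : Integrable W μ)
    (hind : CondIndepFun m' hm W B μ) :
    μ[fun ω => B ω * W ω | m'] =ᵐ[μ] fun ω => (μ[B | m']) ω * (μ[W | m']) ω := by
  have hBi : Integrable B μ := Integrable.of_bound hB.aestronglyMeasurable 1 (ae_of_all _ hBb)
  have hBW : Integrable (fun ω => B ω * W ω) μ :=
    hW.bdd_mul hB.aestronglyMeasurable (ae_of_all _ hBb)
  set V := hW.1.mk W with hV
  have hVm : Measurable V := hW.1.stronglyMeasurable_mk.measurable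
  have hWV := aestronglyMeasurable_trim_condExpKernel hm hW.1
  have hind' : CondIndepFun m' hm V B μ :=
    Kernel.IndepFun.congr' hind hWV (ae_of_all _ fun _ => ae_eq_refl _)
  rw [condIndepFun_iff_map_prod_eq_prod_map_map hVm hB] at hind'
  have h1 := ae_of_ae_trim hm hind'
  have h2 := ae_of_ae_trim hm hWV
  filter_upwards [h1, h2, condExp_ae_eq_integral_condExpKernel hm hBi,
    condExp_ae_eq_integral_condExpKernel hm hW,
    condExp_ae_eq_integral_condExpKernel hm hBW] with ω h1 h2 h3 h4 h5
  rw [h3, h4, h5]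
  have hi : IndepFun V B (condExpKernel μ m' ω) := by
    rw [indepFun_iff_map_prod_eq_prod_map_map hVm.aemeasurable hB.aemeasurable]
    rwa [Kernel.prod_apply, Kernel.map_apply _ hVm, Kernel.map_apply _ hB,
      Kernel.map_apply _ (hVm.prodMk hB)] at h1
  have hi2 : IndepFun B W (condExpKernel μ m' ω) := (hi.congr h2.symm (ae_eq_refl _)).symm
  exact hi2.integral_fun_mul_eq_mul_integral hB.aestronglyMeasurable
    ⟨V, hW.1.stronglyMeasurable_mk, h2⟩

theorem aipw_arm_aux
    {Ω : Type*} {m' mΩ : MeasurableSpace Ω} [StandardBorelSpace Ω]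
    (μ : Measure Ω) [IsProbabilityMeasure μ] (hm : m' ≤ mΩ)
    (B W f g : Ω → ℝ) (hB : Measurable B) (hBb : ∀ ω, ‖B ω‖ ≤ 1) (hW : Integrable W μ)
    (hind : CondIndepFun m' hm W B μ)
    (hpos : ∀ᵐ ω ∂μ, (μ[B | m']) ω ≠ 0)
    (hf : StronglyMeasurable[m'] f) (hfi : Integrable f μ)
    (hreg : μ[fun ω => B ω * W ω | m'] =ᵐ[μ] μ[fun ω => B ω * f ω | m'])
    (hg : StronglyMeasurable[m'] g) (C : ℝ) (hgC : ∀ᵐ ω ∂μ, ‖g ω‖ ≤ C) :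
    Integrable (fun ω => g ω * (B ω * W ω - B ω * f ω) + f ω) μ ∧
    ∫ ω, (g ω * (B ω * W ω - B ω * f ω) + f ω) ∂μ = ∫ ω, W ω ∂μ := by
  have hBi : Integrable B μ := Integrable.of_bound hB.aestronglyMeasurable 1 (ae_of_all _ hBb)
  have hBW : Integrable (fun ω => B ω * W ω) μ :=
    hW.bdd_mul hB.aestronglyMeasurable (ae_of_all _ hBb)
  have hBf : Integrable (fun ω => B ω * f ω) μ :=
    hfi.bdd_mul hB.aestronglyMeasurable (ae_of_all _ hBb)
  have hD : Integrable (fun ω => B ω * W ω - B ω * f ω) μ := hBW.sub hBf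
  have hgD : Integrable (fun ω => g ω * (B ω * W ω - B ω * f ω)) μ :=
    hD.bdd_mul (hg.mono hm).aestronglyMeasurable hgC
  refine ⟨hgD.add hfi, ?_⟩
  rw [integral_add hgD hfi]
  have hz : ∫ ω, g ω * (B ω * W ω - B ω * f ω) ∂μ = 0 := by
    rw [← integral_condExp hm]
    have e1 : μ[fun ω => g ω * (B ω * W ω - B ω * f ω) | m'] =ᵐ[μ] _ :=
      condExp_mul_of_stronglyMeasurable_left hg hgD hD
    have e2 : μ[fun ω => B ω * W ω - B ω * f ω | m'] =ᵐ[μ] _ := condExp_sub hBW hBf m'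
    rw [integral_eq_zero_of_ae]
    filter_upwards [e1, e2, hreg] with ω h1 h2 h3
    rw [h1, Pi.mul_apply, h2, Pi.sub_apply, h3]
    simp
  have hc := condExp_mul_of_condIndepFun_aux μ hm B W hB hBb hW hind
  have hp : μ[fun ω => B ω * f ω | m'] =ᵐ[μ] _ :=
    condExp_mul_of_stronglyMeasurable_right hf hBf hBi
  have hWf : μ[W | m'] =ᵐ[μ] f := by
    filter_upwards [hc, hp, hreg, hpos] with ω h1 h2 h3 h4
    rw [h1, h2, Pi.mul_apply] at h3
    exact mul_left_cancel₀ h4 h3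
  rw [hz, zero_add, ← integral_condExp hm (f := W)]
  exact (integral_congr_ae hWf).symm

/-- Double robustness of AIPW, outcome model correct: with the true outcome regressions
`μ(X,a) = E[Y | X, A = a]` and an arbitrary measurable (possibly misspecified) propensity
model `π(X)` bounded in `[c₁, c₂] ⊂ (0,1)`, under ignorability the AIPW functional
equals `τ₀ = E[Y(1) − Y(0)]`. -/
theorem aipw_doubly_robust_outcome_correct
    {Ω 𝒳 : Type*} [mΩ : MeasurableSpace Ω] [StandardBorelSpace Ω] [MeasurableSpace 𝒳]
    (μ : Measure Ω) [IsProbabilityMeasure μ]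
    (X : Ω → 𝒳) (A : Ω → ℝ) (Y1 Y0 : Ω → ℝ)
    (hX : Measurable X) (hA : Measurable A)
    (hY1 : Integrable Y1 μ) (hY0 : Integrable Y0 μ)
    (hAbin : ∀ ω, A ω = 0 ∨ A ω = 1)
    (Y : Ω → ℝ) (hY : ∀ ω, Y ω = A ω * Y1 ω + (1 - A ω) * Y0 ω)
    -- the true propensity score, satisfying overlap
    (e : 𝒳 → ℝ) (he : Measurable e)
    (heX : (fun ω => e (X ω)) =ᵐ[μ] μ[A | MeasurableSpace.comap X inferInstance])
    (c₁ c₂ : ℝ) (hc₁ : 0 < c₁) (hc₂ : c₂ < 1)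
    (hoverlap : ∀ᵐ ω ∂μ, c₁ ≤ e (X ω) ∧ e (X ω) ≤ c₂)
    -- ignorability
    (hig1 : CondIndepFun (MeasurableSpace.comap X inferInstance) hX.comap_le Y1 A μ)
    (hig0 : CondIndepFun (MeasurableSpace.comap X inferInstance) hX.comap_le Y0 A μ)
    -- the true outcome regressions
    (m1 m0 : 𝒳 → ℝ) (hm1 : Measurable m1) (hm0 : Measurable m0)
    (hm1Int : Integrable (fun ω => m1 (X ω)) μ) (hm0Int : Integrable (fun ω => m0 (X ω)) μ)
    (hm1reg : μ[(fun ω => A ω * Y ω) | MeasurableSpace.comap X inferInstance]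
        =ᵐ[μ] μ[(fun ω => A ω * m1 (X ω)) | MeasurableSpace.comap X inferInstance])
    (hm0reg : μ[(fun ω => (1 - A ω) * Y ω) | MeasurableSpace.comap X inferInstance]
        =ᵐ[μ] μ[(fun ω => (1 - A ω) * m0 (X ω)) | MeasurableSpace.comap X inferInstance])
    -- arbitrary measurable (possibly misspecified) propensity model with values in [c₁, c₂]
    (π : 𝒳 → ℝ) (hπ : Measurable π)
    (hπbdd : ∀ᵐ ω ∂μ, c₁ ≤ π (X ω) ∧ π (X ω) ≤ c₂) :
    ∫ ω, (A ω * Y ω / π (X ω) + (1 - A ω / π (X ω)) * m1 (X ω)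
        - (1 - A ω) * Y ω / (1 - π (X ω))
        - (1 - (1 - A ω) / (1 - π (X ω))) * m0 (X ω)) ∂μ
      = ∫ ω, (Y1 ω - Y0 ω) ∂μ := by
  have hm := hX.comap_le
  have hXm : Measurable[MeasurableSpace.comap X inferInstance] X := comap_measurable X
  have hAb : ∀ ω, ‖A ω‖ ≤ 1 := fun ω => by rcases hAbin ω with h | h <;> simp [h]
  have hAb' : ∀ ω, ‖1 - A ω‖ ≤ 1 := fun ω => by rcases hAbin ω with h | h <;> simp [h]
  have hAi : Integrable A μ := Integrable.of_bound hA.aestronglyMeasurable 1 (ae_of_all _ hAb)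
  have hAY : (fun ω => A ω * Y ω) = fun ω => A ω * Y1 ω := by
    funext ω; rw [hY]; rcases hAbin ω with h | h <;> simp [h]
  have hAY' : (fun ω => (1 - A ω) * Y ω) = fun ω => (1 - A ω) * Y0 ω := by
    funext ω; rw [hY]; rcases hAbin ω with h | h <;> simp [h]
  rw [hAY] at hm1reg
  rw [hAY'] at hm0reg
  have hcs : μ[fun ω => 1 - A ω | MeasurableSpace.comap X inferInstance] =ᵐ[μ] _ :=
    condExp_sub (integrable_const (1 : ℝ)) hAi (MeasurableSpace.comap X inferInstance)
  obtain ⟨i1, e1⟩ := aipw_arm_aux μ hm A Y1 (fun ω => m1 (X ω)) (fun ω => (π (X ω))⁻¹)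
    hA hAb hY1 hig1
    (by filter_upwards [heX, hoverlap] with ω h1 h2
        rw [← h1]
        have : 0 < e (X ω) := by linarith [h2.1]
        exact this.ne')
    (hm1.comp hXm).stronglyMeasurable hm1Int hm1reg
    (hπ.comp hXm).inv.stronglyMeasurable c₁⁻¹
    (by filter_upwards [hπbdd] with ω h
        rw [norm_inv, Real.norm_of_nonneg (by linarith [h.1])]
        exact inv_anti₀ hc₁ h.1)
  obtain ⟨i0, e0⟩ := aipw_arm_aux μ hm (fun ω => 1 - A ω) Y0 (fun ω => m0 (X ω))
    (fun ω => (1 - π (X ω))⁻¹)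
    (measurable_const.sub hA) hAb' hY0
    (hig0.comp measurable_id (measurable_const.sub measurable_id : Measurable fun x : ℝ => 1 - x))
    (by filter_upwards [heX, hoverlap, hcs] with ω h1 h2 h3
        rw [h3, Pi.sub_apply, ← h1, condExp_const hm]
        have : 0 < 1 - e (X ω) := by linarith [h2.2]
        exact this.ne')
    (hm0.comp hXm).stronglyMeasurable hm0Int hm0reg
    (measurable_const.sub (hπ.comp hXm)).inv.stronglyMeasurable (1 - c₂)⁻¹
    (by filter_upwards [hπbdd] with ω h
        rw [norm_inv, Real.norm_of_nonneg (by linarith [h.2])]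
        exact inv_anti₀ (by linarith) (by linarith [h.2]))
  rw [integral_sub hY1 hY0, ← e1, ← e0, ← integral_sub i1 i0]
  congr 1
  funext ω
  have a1 := congrFun hAY ω
  have a0 := congrFun hAY' ω
  rw [a1, a0]
  simp only [div_eq_mul_inv]
  ring
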